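/- Let k be a field and n ≥ 1. In the polynomial ring k[x₀,…,xₙ,y₀,…,yₙ], the ideal I generated by the 2×2 minors xᵢyⱼ − xⱼyᵢ for 0 ≤ i < j ≤ n has height (codimension) equal to n. -/

import Mathlib

open MvPolynomial

/-- The height (codimension) of an ideal `I` in a commutative ring: the infimum of the
heights of the prime ideals containing `I`, where the height of a prime is its height
as an element of the prime spectrum ordered by inclusion. -/
noncomputable def Ideal.heightOfIdeal {R : Type*} [CommRing R] (I : Ideal R) : ℕ∞ :=
  ⨅ (P : PrimeSpectrum R) (_ : I ≤ P.asIdeal), Order.height P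

lemma Finset.card_le_height_of_lt_insert {α ι : Type*} [Preorder α] [DecidableEq ι]
    (Q : Finset ι → α) (T : Finset ι)
    (h : ∀ j ∈ T, ∀ S, j ∉ S → Q S < Q (insert j S)) :
    (T.card : ℕ∞) ≤ Order.height (Q T) := by
  induction T using Finset.induction_on with
  | empty => simp
  | insert a T ha ih =>
    rw [Finset.card_insert_of_notMem ha, Nat.cast_add, Nat.cast_one]
    calc (T.card : ℕ∞) + 1 ≤ Order.height (Q T) + 1 := by
          gcongr
          exact ih fun j hj => h j (Finset.mem_insert_of_mem hj)
      _ ≤ Order.height (Q (insert a T)) :=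
          Order.height_add_one_le (h a (Finset.mem_insert_self a T) T ha)

namespace GenericMinors

variable {k ι : Type*} [Field k] [DecidableEq ι]

/-- The minor `xᵢyⱼ − xⱼyᵢ`. -/
noncomputable def minor (k : Type*) [Field k] {ι : Type*} (i j : ι) : MvPolynomial (ι ⊕ ι) k :=
  X (Sum.inl i) * X (Sum.inr j) - X (Sum.inl j) * X (Sum.inr i)

/-- The substitution `yⱼ ↦ t xⱼ` for `j ∈ S`, fixing all other variables. -/
noncomputable def slopeHom (k : Type*) [Field k] {ι : Type*} [DecidableEq ι] (S : Finset ι) :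
    MvPolynomial (ι ⊕ ι) k →ₐ[k] Polynomial (MvPolynomial (ι ⊕ ι) k) :=
  aeval (Sum.elim (fun j => Polynomial.C (X (Sum.inl j)))
    (fun j => if j ∈ S then Polynomial.C (X (Sum.inl j)) * Polynomial.X
      else Polynomial.C (X (Sum.inr j))))

@[simp]
lemma slopeHom_X_inl (S : Finset ι) (j : ι) :
    slopeHom k S (X (Sum.inl j)) = Polynomial.C (X (Sum.inl j)) := by
  simp [slopeHom]

lemma slopeHom_X_inr (S : Finset ι) (j : ι) :
    slopeHom k S (X (Sum.inr j)) = if j ∈ S then Polynomial.C (X (Sum.inl j)) * Polynomial.X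
      else Polynomial.C (X (Sum.inr j)) := by
  simp [slopeHom]

/-- The kernel of `slopeHom`, as a point of the spectrum. -/
noncomputable def slopePrime (k : Type*) [Field k] {ι : Type*} [DecidableEq ι] (S : Finset ι) :
    PrimeSpectrum (MvPolynomial (ι ⊕ ι) k) :=
  ⟨RingHom.ker (slopeHom k S), RingHom.ker_isPrime _⟩

lemma mem_slopePrime {S : Finset ι} {f : MvPolynomial (ι ⊕ ι) k} :
    f ∈ (slopePrime k S).asIdeal ↔ slopeHom k S f = 0 := Iff.rfl

lemma X_inl_notMem_slopePrime (S : Finset ι) (i : ι) :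
    X (Sum.inl i) ∉ (slopePrime k S).asIdeal := by
  simp [mem_slopePrime]

lemma minor_mem_slopePrime {S : Finset ι} {i j : ι} (hi : i ∈ S) (hj : j ∈ S) :
    minor k i j ∈ (slopePrime k S).asIdeal := by
  rw [mem_slopePrime, minor, map_sub, map_mul, map_mul, slopeHom_X_inl, slopeHom_X_inl,
    slopeHom_X_inr, slopeHom_X_inr, if_pos hi, if_pos hj]
  ring

lemma minor_notMem_slopePrime {S : Finset ι} {i j : ι} (hi : i ∈ S) (hj : j ∉ S) :
    minor k i j ∉ (slopePrime k S).asIdeal := by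
  rw [mem_slopePrime, minor, map_sub, map_mul, map_mul, slopeHom_X_inl, slopeHom_X_inl,
    slopeHom_X_inr, slopeHom_X_inr, if_pos hi, if_neg hj]
  intro h
  have := congrArg (fun p => Polynomial.coeff p 0) h
  simp [Polynomial.mul_coeff_zero] at this

/-- A prime avoiding `xᵢ` in which all the minors `xᵢyⱼ − xⱼyᵢ` with `j ∈ S` vanish contains
the kernel of `slopeHom k S`: send `t` to `yᵢ / xᵢ` in its residue field. -/
lemma slopePrime_le {S : Finset ι} {i : ι} {P : PrimeSpectrum (MvPolynomial (ι ⊕ ι) k)}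
    (hx : X (Sum.inl i) ∉ P.asIdeal) (hP : ∀ j ∈ S, minor k i j ∈ P.asIdeal) :
    slopePrime k S ≤ P := by
  let π : MvPolynomial (ι ⊕ ι) k →+* P.asIdeal.ResidueField :=
    algebraMap (MvPolynomial (ι ⊕ ι) k) P.asIdeal.ResidueField
  have hπ (f) : π f = 0 ↔ f ∈ P.asIdeal := Ideal.algebraMap_residueField_eq_zero
  have hx0 : π (X (Sum.inl i)) ≠ 0 := fun h => hx ((hπ _).1 h)
  let ψ := Polynomial.eval₂RingHom π (π (X (Sum.inr i)) / π (X (Sum.inl i)))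
  have hψ : ψ.comp (slopeHom k S).toRingHom = π := by
    refine MvPolynomial.ringHom_ext (fun c => ?_) ?_
    · have : slopeHom k S (C c) = Polynomial.C (C c) := by
        simp [slopeHom]
      simp [ψ, this]
    · rintro (j | j)
      · simp [ψ]
      · by_cases hj : j ∈ S
        · have h := (hπ _).2 (hP j hj)
          rw [minor, map_sub, map_mul, map_mul, sub_eq_zero] at h
          simp only [RingHom.comp_apply, AlgHom.toRingHom_eq_coe, RingHom.coe_coe,
            slopeHom_X_inr, if_pos hj, ψ, Polynomial.coe_eval₂RingHom, Polynomial.eval₂_mul,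
            Polynomial.eval₂_C, Polynomial.eval₂_X]
          rw [← mul_div_assoc, div_eq_iff hx0, ← h, mul_comm]
        · simp [ψ, slopeHom_X_inr, hj]
  intro f hf
  rw [← hπ, ← hψ]
  have : slopeHom k S f = 0 := hf
  simp [this]

lemma slopePrime_lt_insert {S : Finset ι} {i j : ι} (hi : i ∈ S) (hj : j ∉ S) :
    slopePrime k S < slopePrime k (insert j S) := by
  refine lt_of_le_not_ge (slopePrime_le (X_inl_notMem_slopePrime _ i) fun l hl =>
    minor_mem_slopePrime (Finset.mem_insert_of_mem hi) (Finset.mem_insert_of_mem hl)) fun h => ?_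
  exact minor_notMem_slopePrime (k := k) hi hj
    (h (minor_mem_slopePrime (Finset.mem_insert_of_mem hi) (Finset.mem_insert_self j S)))

/-- The substitution `xⱼ ↦ 0` for `j ∈ S`, fixing all other variables. -/
noncomputable def zeroHom (k : Type*) [Field k] {ι : Type*} [DecidableEq ι] (S : Finset ι) :
    MvPolynomial (ι ⊕ ι) k →ₐ[k] MvPolynomial (ι ⊕ ι) k :=
  aeval (Sum.elim (fun j => if j ∈ S then 0 else X (Sum.inl j)) (fun j => X (Sum.inr j)))

lemma zeroHom_X_inl (S : Finset ι) (j : ι) :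
    zeroHom k S (X (Sum.inl j)) = if j ∈ S then 0 else X (Sum.inl j) := by
  simp [zeroHom]

/-- The kernel of `zeroHom`, as a point of the spectrum. -/
noncomputable def zeroPrime (k : Type*) [Field k] {ι : Type*} [DecidableEq ι] (S : Finset ι) :
    PrimeSpectrum (MvPolynomial (ι ⊕ ι) k) :=
  ⟨RingHom.ker (zeroHom k S), RingHom.ker_isPrime _⟩

lemma X_inl_mem_zeroPrime {S : Finset ι} {j : ι} :
    X (Sum.inl j) ∈ (zeroPrime k S).asIdeal ↔ j ∈ S := by
  change zeroHom k S _ = 0 ↔ _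
  rw [zeroHom_X_inl]
  split_ifs with h <;> simp [h]

lemma zeroPrime_le {S : Finset ι} {P : PrimeSpectrum (MvPolynomial (ι ⊕ ι) k)}
    (hP : ∀ j ∈ S, X (Sum.inl j) ∈ P.asIdeal) : zeroPrime k S ≤ P := by
  have hπ : (Ideal.Quotient.mkₐ k P.asIdeal).comp (zeroHom k S) =
      Ideal.Quotient.mkₐ k P.asIdeal := by
    refine MvPolynomial.algHom_ext ?_
    rintro (j | j)
    · by_cases hj : j ∈ S
      · simpa [zeroHom_X_inl, hj, eq_comm] using Ideal.Quotient.eq_zero_iff_mem.2 (hP j hj)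
      · simp [zeroHom_X_inl, hj]
    · simp [zeroHom]
  intro f hf
  have hf : zeroHom k S f = 0 := hf
  have h := DFunLike.congr_fun hπ f
  rw [AlgHom.comp_apply, hf, map_zero] at h
  exact Ideal.Quotient.eq_zero_iff_mem.1 h.symm

lemma zeroPrime_lt_insert {S : Finset ι} {j : ι} (hj : j ∉ S) :
    zeroPrime k S < zeroPrime k (insert j S) := by
  refine lt_of_le_not_ge (zeroPrime_le fun l hl =>
    X_inl_mem_zeroPrime.2 (Finset.mem_insert_of_mem hl)) fun h => hj ?_
  exact X_inl_mem_zeroPrime.1 (h (X_inl_mem_zeroPrime (k := k).2 (Finset.mem_insert_self j S)))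

lemma card_sub_one_le_height [Fintype ι] (P : PrimeSpectrum (MvPolynomial (ι ⊕ ι) k))
    (hP : ∀ i j, minor k i j ∈ P.asIdeal) :
    ((Fintype.card ι - 1 : ℕ) : ℕ∞) ≤ Order.height P := by
  by_cases hx : ∀ i, X (Sum.inl i) ∈ P.asIdeal
  · calc ((Fintype.card ι - 1 : ℕ) : ℕ∞) ≤ (Finset.univ : Finset ι).card := by
          exact_mod_cast Nat.sub_le _ _
      _ ≤ Order.height (zeroPrime k (Finset.univ : Finset ι)) :=
          Finset.card_le_height_of_lt_insert _ _ fun j _ S hj => zeroPrime_lt_insert hj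
      _ ≤ Order.height P := Order.height_mono (zeroPrime_le fun j _ => hx j)
  · push Not at hx
    obtain ⟨i, hi⟩ := hx
    calc ((Fintype.card ι - 1 : ℕ) : ℕ∞) = ((Finset.univ : Finset ι).erase i).card := by
          simp [Finset.card_erase_of_mem]
      _ ≤ Order.height (slopePrime k (insert i ((Finset.univ : Finset ι).erase i))) := by
          refine Finset.card_le_height_of_lt_insert (fun S => slopePrime k (insert i S)) _
            fun j hj S hjS => ?_
          rw [Finset.insert_comm]
          exact slopePrime_lt_insert (Finset.mem_insert_self i S)
            (by simp [Finset.ne_of_mem_erase hj, hjS])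
      _ ≤ Order.height P := Order.height_mono (slopePrime_le hi fun j _ => hP i j)

lemma height_slopePrime_univ_le [Fintype ι] (i : ι) :
    Order.height (slopePrime k (Finset.univ : Finset ι)) ≤ (Fintype.card ι - 1 : ℕ) := by
  classical
  let s : Finset (MvPolynomial (ι ⊕ ι) k) := (Finset.univ.erase i).image (minor k i)
  have hs : s.card ≤ Fintype.card ι - 1 :=
    Finset.card_image_le.trans (by simp [Finset.card_erase_of_mem])
  have hmin : (slopePrime k (Finset.univ : Finset ι)).asIdeal ∈
      (Ideal.span (s : Set (MvPolynomial (ι ⊕ ι) k))).minimalPrimes := by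
    refine ⟨⟨(slopePrime k _).isPrime, Ideal.span_le.2 fun f hf => ?_⟩, ?_⟩
    · obtain ⟨j, -, rfl⟩ := Finset.mem_image.1 hf
      exact minor_mem_slopePrime (Finset.mem_univ i) (Finset.mem_univ j)
    · rintro Q ⟨hQ, hsQ⟩ hle
      refine slopePrime_le (P := ⟨Q, hQ⟩) (i := i)
        (fun h => X_inl_notMem_slopePrime _ i (hle h)) fun j _ => ?_
      by_cases hj : j = i
      · simp [hj, minor]
      · exact hsQ (Ideal.subset_span
          (Finset.mem_image_of_mem _ (Finset.mem_erase.2 ⟨hj, Finset.mem_univ j⟩)))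
  rw [← PrimeSpectrum.height_eq_orderHeight]
  exact (Ideal.height_le_card_of_mem_minimalPrimes_span_finset hmin).trans (by exact_mod_cast hs)

end GenericMinors

open GenericMinors

/-- Let `k` be a field and `n ≥ 1`. In the polynomial ring
`k[x₀,…,xₙ,y₀,…,yₙ]` (variables indexed by `Fin (n+1) ⊕ Fin (n+1)`, with `Sum.inl i ↦ xᵢ`
and `Sum.inr i ↦ yᵢ`), the ideal generated by the `2×2` minors `xᵢyⱼ − xⱼyᵢ` for
`0 ≤ i < j ≤ n` has height `n`. -/
theorem height_span_minors
    (k : Type*) [Field k] (n : ℕ) (hn : 1 ≤ n) :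
    (Ideal.span { f : MvPolynomial (Fin (n + 1) ⊕ Fin (n + 1)) k |
        ∃ i j : Fin (n + 1), i < j ∧
          f = X (Sum.inl i) * X (Sum.inr j) - X (Sum.inl j) * X (Sum.inr i) }).heightOfIdeal
      = (n : ℕ∞) := by
  refine le_antisymm ?_ (le_iInf₂ fun P hP => ?_)
  · refine (iInf₂_le (slopePrime k Finset.univ) (Ideal.span_le.2 ?_)).trans
      ((height_slopePrime_univ_le 0).trans (by simp))
    rintro f ⟨i, j, -, rfl⟩
    exact minor_mem_slopePrime (Finset.mem_univ i) (Finset.mem_univ j)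
  · have hlt (i j : Fin (n + 1)) (hij : i < j) : minor k i j ∈ P.asIdeal :=
      hP (Ideal.subset_span ⟨i, j, hij, rfl⟩)
    have h := card_sub_one_le_height P fun i j => by
      rcases lt_trichotomy i j with hij | rfl | hij
      · exact hlt i j hij
      · simp [minor]
      · rw [← neg_mem_iff]
        simpa [minor] using hlt j i hij
    simpa using h
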